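/- arXiv:2104.00104 — 2 statements merged into one kernel-verified Lean document; each statement's English description precedes it below -/
import Mathlib

section
/- Let G = (V,E) be a finite simple undirected graph, let I ⊆ V be an independent set with |I| ≥ 2, and assign to each vertex of I a distinct binary label of length r. For each i ∈ {1,…,r} let A_i (resp. B_i) be the vertices of I whose label's i-th bit is 0 (resp. 1), and whenever A_i and B_i are both nonempty let C_i be an (A_i,B_i)-min-separator (C_i = ∅ otherwise). Fix v ∈ I and let λ_v be the minimum size of a ({v}, I \ {v})-separator. Suppose S* ⊆ V satisfies: v ∈ S*, S* ∩ I = {v}, N(S*) ∩ I = ∅, |N(S*)| = λ_v, the induced subgraph G[S*] is connected, and S* is inclusion-wise minimal in the sense that no proper subset S ⊊ S* with v ∈ S satisfies S ∩ I = {v}, N(S) ∩ I = ∅ and |N(S)| ≤ λ_v. Then S* is contained in the connected component of v in G − ⋃_i C_i. -/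
/-- The open neighborhood `N(X) = {w ∉ X : w has a neighbor in X}` of a vertex set `X`,
as a `Finset`. -/
def openNbhd {V : Type*} [Fintype V] [DecidableEq V]
    (G : SimpleGraph V) [DecidableRel G.Adj] (X : Finset V) : Finset V :=
  Finset.univ.filter fun w => w ∉ X ∧ ∃ u ∈ X, G.Adj u w

/-- `C` is an `(A, B)`-separator in `G`: `C` is disjoint from `A ∪ B` and, after deleting
the vertices of `C`, no vertex of `A` lies in the same connected component as a vertex of
`B` (i.e. every walk from a vertex of `A` to a vertex of `B` meets `C`). -/
def IsSeparator {V : Type*} [DecidableEq V] (G : SimpleGraph V) (A B C : Finset V) : Prop :=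
  Disjoint C (A ∪ B) ∧
    ∀ a ∈ A, ∀ b ∈ B, ∀ p : G.Walk a b, ∃ w ∈ p.support, w ∈ C

/-- An `(A, B)`-min-separator: an `(A, B)`-separator of minimum size. -/
def IsMinSeparator {V : Type*} [DecidableEq V] (G : SimpleGraph V) (A B C : Finset V) : Prop :=
  IsSeparator G A B C ∧ ∀ C' : Finset V, IsSeparator G A B C' → C.card ≤ C'.card

theorem mem_openNbhd' {V : Type*} [Fintype V] [DecidableEq V]
    (G : SimpleGraph V) [DecidableRel G.Adj] (X : Finset V) (w : V) :
    w ∈ openNbhd G X ↔ w ∉ X ∧ ∃ u ∈ X, G.Adj u w := by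
  simp [openNbhd]

theorem openNbhd_submod {V : Type*} [Fintype V] [DecidableEq V]
    (G : SimpleGraph V) [DecidableRel G.Adj] (S X : Finset V) :
    (openNbhd G (S ∩ X)).card + (openNbhd G (S ∪ X)).card
      ≤ (openNbhd G S).card + (openNbhd G X).card := by
  rw [← Finset.card_union_add_card_inter, ← Finset.card_union_add_card_inter (openNbhd G S)]
  apply Nat.add_le_add <;> apply Finset.card_le_card <;> intro w hw <;>
    simp only [Finset.mem_union, Finset.mem_inter, mem_openNbhd'] at hw ⊢ <;> grind

theorem isSeparator_openNbhd {V : Type*} [Fintype V] [DecidableEq V]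
    (G : SimpleGraph V) [DecidableRel G.Adj] (A B X : Finset V)
    (hA : ∀ a ∈ A, a ∈ X) (hB : ∀ b ∈ B, b ∉ X)
    (hN : ∀ b ∈ B, b ∉ openNbhd G X) : IsSeparator G A B (openNbhd G X) := by
  refine ⟨?_, ?_⟩
  · rw [Finset.disjoint_left]
    intro w hw hw'
    rcases Finset.mem_union.1 hw' with h | h
    · exact ((mem_openNbhd' G X w).1 hw).1 (hA w h)
    · exact hN w h hw
  · intro a ha b hb p
    obtain ⟨d, hd, h1, h2⟩ := p.exists_boundary_dart (X : Set V) (hA a ha) (hB b hb)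
    exact ⟨d.snd, p.dart_snd_mem_support_of_mem_darts hd,
      (mem_openNbhd' G X _).2 ⟨h2, d.fst, h1, d.adj⟩⟩

theorem isSeparator_symm {V : Type*} [DecidableEq V]
    {G : SimpleGraph V} {A B C : Finset V} (h : IsSeparator G A B C) : IsSeparator G B A C := by
  refine ⟨by rw [Finset.union_comm]; exact h.1, fun b hb a ha p => ?_⟩
  obtain ⟨w, hw, hwC⟩ := h.2 a ha b hb p.reverse
  exact ⟨w, by simpa using hw, hwC⟩

theorem isMinSeparator_symm {V : Type*} [DecidableEq V]
    {G : SimpleGraph V} {A B C : Finset V} (h : IsMinSeparator G A B C) :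
    IsMinSeparator G B A C :=
  ⟨isSeparator_symm h.1, fun C' hC' => h.2 C' (isSeparator_symm hC')⟩

/-- Uncrossing: the minimal set avoids every min-separator. -/
theorem uncross {V : Type*} [Fintype V] [DecidableEq V]
    (G : SimpleGraph V) [DecidableRel G.Adj]
    (I A B C : Finset V) (hAI : A ⊆ I) (hBI : B ⊆ I) (hI : I ⊆ A ∪ B) (hAB : Disjoint A B)
    (hC : IsMinSeparator G A B C)
    (v : V) (hv : v ∈ A) (lam : ℕ)
    (hlam_min : ∀ C₀ : Finset V, IsSeparator G {v} (I \ {v}) C₀ → lam ≤ C₀.card)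
    (S : Finset V) (hvS : v ∈ S) (hSI : S ∩ I = {v})
    (hNI : openNbhd G S ∩ I = ∅) (hNcard : (openNbhd G S).card = lam)
    (hmin : ∀ T : Finset V, T ⊂ S → v ∈ T →
      ¬ (T ∩ I = {v} ∧ openNbhd G T ∩ I = ∅ ∧ (openNbhd G T).card ≤ lam)) :
    ∀ w ∈ S, w ∉ C := by
  classical
  obtain ⟨⟨hdis, hsep⟩, hCmin⟩ := hC
  rw [Finset.disjoint_left] at hdis hAB
  let X : Finset V := Finset.univ.filter fun w =>
    ∃ a ∈ A, ∃ p : G.Walk a w, ∀ u ∈ p.support, u ∉ C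
  have hX : ∀ w, w ∈ X ↔ ∃ a ∈ A, ∃ p : G.Walk a w, ∀ u ∈ p.support, u ∉ C := by
    intro w; simp [X]
  have hXC : ∀ w ∈ X, w ∉ C := by
    intro w hw
    obtain ⟨a, _, p, hp⟩ := (hX w).1 hw
    exact hp w p.end_mem_support
  have hAX : ∀ a ∈ A, a ∈ X := by
    intro a ha
    refine (hX a).2 ⟨a, ha, SimpleGraph.Walk.nil, ?_⟩
    intro u hu
    have : u = a := by simpa using hu
    subst this
    exact fun h => hdis h (Finset.mem_union_left _ ha)
  have hBX : ∀ b ∈ B, b ∉ X := by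
    intro b hb hbX
    obtain ⟨a, ha, p, hp⟩ := (hX b).1 hbX
    obtain ⟨w, hw, hwC⟩ := hsep a ha b hb p
    exact hp w hw hwC
  have hNX : openNbhd G X ⊆ C := by
    intro w hw
    obtain ⟨hwX, u, hu, huw⟩ := (mem_openNbhd' G X w).1 hw
    by_contra hwC
    obtain ⟨a, ha, p, hp⟩ := (hX u).1 hu
    refine hwX ((hX w).2 ⟨a, ha, p.concat huw, ?_⟩)
    intro x hx
    rw [SimpleGraph.Walk.support_concat] at hx
    simp only [List.concat_eq_append, List.mem_append, List.mem_singleton] at hx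
    rcases hx with hx | rfl
    · exact hp x hx
    · exact hwC
  have hIN : ∀ w ∈ I, w ∉ openNbhd G S := by
    intro w hw h
    have : w ∈ openNbhd G S ∩ I := Finset.mem_inter.2 ⟨h, hw⟩
    simp [hNI] at this
  have hIX : ∀ w ∈ I, w ∉ openNbhd G X := fun w hw h => hdis (hNX h) (hI hw)
  have hSv : ∀ w ∈ I, w ∈ S → w = v := by
    intro w hw h
    have : w ∈ S ∩ I := Finset.mem_inter.2 ⟨h, hw⟩
    simpa [hSI] using this
  have hIcap : ∀ w ∈ I, w ∉ openNbhd G (S ∩ X) := by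
    intro w hw h
    have h1 := hIN w hw
    have h2 := hIX w hw
    rw [mem_openNbhd'] at h h1 h2
    grind
  have hIcup : ∀ w ∈ I, w ∉ openNbhd G (S ∪ X) := by
    intro w hw h
    have h1 := hIN w hw
    have h2 := hIX w hw
    rw [mem_openNbhd'] at h h1 h2
    grind
  have h2 : C.card ≤ (openNbhd G (S ∪ X)).card := by
    apply hCmin
    apply isSeparator_openNbhd
    · intro a ha; exact Finset.mem_union_right _ (hAX a ha)
    · intro b hb h
      rcases Finset.mem_union.1 h with h | h
      · have := hSv b (hBI hb) h
        subst this
        exact hAB hv hb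
      · exact hBX b hb h
    · intro b hb; exact hIcup b (hBI hb)
  have h3 := openNbhd_submod G S X
  have h4 := Finset.card_le_card hNX
  have hvT : v ∈ S ∩ X := Finset.mem_inter.2 ⟨hvS, hAX v hv⟩
  have hle : (openNbhd G (S ∩ X)).card ≤ lam := by omega
  by_cases hEq : S ∩ X = S
  · intro w hw
    rw [← hEq] at hw
    exact hXC w (Finset.mem_inter.1 hw).2
  · exfalso
    refine hmin (S ∩ X) (Finset.inter_subset_left.ssubset_of_ne hEq) hvT ⟨?_, ?_, hle⟩
    · ext w
      simp only [Finset.mem_inter, Finset.mem_singleton]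
      constructor
      · rintro ⟨⟨h, _⟩, hw⟩; exact hSv w hw h
      · rintro rfl; exact ⟨Finset.mem_inter.1 hvT, hAI hv⟩
    · ext w
      simp only [Finset.mem_inter, Finset.notMem_empty, iff_false]
      rintro ⟨h, hw⟩; exact hIcap w hw h

/-- Let `G` be a finite simple undirected graph, `I` an independent set
with `|I| ≥ 2` whose vertices carry distinct binary labels of length `r`. For each `i`,
let `A i` (resp. `B i`) be the vertices of `I` whose label's `i`-th bit is `0` (resp.
`1`), and whenever both are nonempty let `C i` be an `(A i, B i)`-min-separator
(`C i = ∅` otherwise). Fix `v ∈ I` and let `lam` be the minimum size of a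
`({v}, I \ {v})`-separator. Suppose `S*` satisfies: `v ∈ S*`, `S* ∩ I = {v}`,
`N(S*) ∩ I = ∅`, `|N(S*)| = lam`, the induced subgraph `G[S*]` is connected, and `S*` is
inclusion-wise minimal in the sense that no proper subset `S ⊊ S*` with `v ∈ S` satisfies
`S ∩ I = {v}`, `N(S) ∩ I = ∅`, and `|N(S)| ≤ lam`. Then `S*` is contained in the
connected component of `v` in `G − ⋃ i, C i`. -/
theorem stmt11 {V : Type*} [Fintype V] [DecidableEq V]
    (G : SimpleGraph V) [DecidableRel G.Adj]
    (I : Finset V) (hind : ∀ u ∈ I, ∀ v ∈ I, ¬ G.Adj u v) (hI2 : 2 ≤ I.card)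
    (r : ℕ) (label : V → Fin r → Bool) (hinj : Set.InjOn label ↑I)
    (A B C : Fin r → Finset V)
    (hA : ∀ i, A i = I.filter fun u => label u i = false)
    (hB : ∀ i, B i = I.filter fun u => label u i = true)
    (hC : ∀ i, (A i).Nonempty → (B i).Nonempty → IsMinSeparator G (A i) (B i) (C i))
    (hC0 : ∀ i, ¬ ((A i).Nonempty ∧ (B i).Nonempty) → C i = ∅)
    (v : V) (hv : v ∈ I)
    (lam : ℕ)
    (hlam_ex : ∃ C₀ : Finset V, IsSeparator G {v} (I \ {v}) C₀ ∧ C₀.card = lam)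
    (hlam_min : ∀ C₀ : Finset V, IsSeparator G {v} (I \ {v}) C₀ → lam ≤ C₀.card)
    (Sstar : Finset V)
    (hvS : v ∈ Sstar)
    (hSI : Sstar ∩ I = {v})
    (hNI : openNbhd G Sstar ∩ I = ∅)
    (hNcard : (openNbhd G Sstar).card = lam)
    (hconn : ∀ a ∈ Sstar, ∀ b ∈ Sstar, ∃ p : G.Walk a b, ∀ w ∈ p.support, w ∈ Sstar)
    (hmin : ∀ S : Finset V, S ⊂ Sstar → v ∈ S →
      ¬ (S ∩ I = {v} ∧ openNbhd G S ∩ I = ∅ ∧ (openNbhd G S).card ≤ lam)) :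
    ∀ w ∈ Sstar, ∃ p : G.Walk v w, ∀ u ∈ p.support, ∀ i, u ∉ C i := by
  have key : ∀ i, ∀ w ∈ Sstar, w ∉ C i := by
    intro i
    by_cases hne : (A i).Nonempty ∧ (B i).Nonempty
    · have hm := hC i hne.1 hne.2
      have hAI : A i ⊆ I := by rw [hA]; exact Finset.filter_subset _ _
      have hBI : B i ⊆ I := by rw [hB]; exact Finset.filter_subset _ _
      have hI : I ⊆ A i ∪ B i := by
        intro w hw
        rw [hA, hB, Finset.mem_union, Finset.mem_filter, Finset.mem_filter]
        cases label w i <;> simp [hw]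
      have hAB : Disjoint (A i) (B i) := by
        rw [Finset.disjoint_left]
        intro w h1 h2
        rw [hA, Finset.mem_filter] at h1
        rw [hB, Finset.mem_filter] at h2
        simp [h1.2] at h2
      rcases Finset.mem_union.1 (hI hv) with h | h
      · exact uncross G I (A i) (B i) (C i) hAI hBI hI hAB hm v h lam hlam_min Sstar hvS hSI hNI
          hNcard hmin
      · exact uncross G I (B i) (A i) (C i) hBI hAI (by rwa [Finset.union_comm]) hAB.symm
          (isMinSeparator_symm hm) v h lam hlam_min Sstar hvS hSI hNI hNcard hmin
    · intro w _
      rw [hC0 i hne]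
      exact Finset.notMem_empty w
  intro w hw
  obtain ⟨p, hp⟩ := hconn v hvS w hw
  exact ⟨p, fun u hu i => key i u (hp u hu)⟩
end

section
/- Let G = (V,E) be a finite simple undirected graph, v a vertex, and T a nonempty vertex set with v ∉ T such that some ({v},T)-separator exists. Let C be a ({v},T)-min-separator and let S be the vertex set of the connected component of v in G − C. Then N(S) = C. -/
theorem exists_boundary {V : Type*} (G : SimpleGraph V) (S : Set V) {a b : V}
    (p : G.Walk a b) : a ∈ S → b ∉ S → ∃ w ∈ p.support, w ∉ S ∧ ∃ u ∈ S, G.Adj u w := by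
  induction p with
  | nil => intro h1 h2; exact absurd h1 h2
  | @cons x y z h p ih =>
    intro h1 h2
    by_cases hy : y ∈ S
    · obtain ⟨w, hw, hw'⟩ := ih hy h2
      exact ⟨w, by simp [hw], hw'⟩
    · exact ⟨y, by simp, hy, x, h1, h⟩

/-- Let `G` be a finite simple undirected graph, `v` a vertex, and `T`
a nonempty vertex set with `v ∉ T` such that some `({v}, T)`-separator exists. Let `C` be
a `({v}, T)`-min-separator and let `S` be the vertex set of the connected component of
`v` in `G − C` (the set of vertices reachable from `v` by walks avoiding `C`). Then
`N(S) = C`. -/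
theorem stmt12 {V : Type*} [Fintype V] [DecidableEq V] (G : SimpleGraph V)
    (v : V) (T : Finset V) (hT : T.Nonempty) (hvT : v ∉ T)
    (hex : ∃ C₀ : Finset V, IsSeparator G {v} T C₀)
    (C : Finset V) (hC : IsMinSeparator G {v} T C)
    (S : Set V)
    (hS : S = {w : V | ∃ p : G.Walk v w, ∀ u ∈ p.support, u ∉ C}) :
    {w : V | w ∉ S ∧ ∃ u ∈ S, G.Adj u w} = (↑C : Set V) := by
  classical
  obtain ⟨⟨hd, hsep⟩, hmin⟩ := hC
  have hsub : ∀ w, w ∉ S → (∃ u ∈ S, G.Adj u w) → w ∈ C := by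
    subst hS
    rintro w hw ⟨u, ⟨p, hp⟩, hadj⟩
    by_contra hwC
    apply hw
    refine ⟨p.concat hadj, ?_⟩
    intro x hx
    rw [SimpleGraph.Walk.support_concat] at hx
    simp only [List.concat_eq_append, List.mem_append, List.mem_singleton] at hx
    rcases hx with hx | rfl
    · exact hp x hx
    · exact hwC
  have hvC : v ∉ C := fun h => Finset.disjoint_left.mp hd h (by simp)
  have hvS : v ∈ S := by
    subst hS
    exact ⟨SimpleGraph.Walk.nil, by simpa using hvC⟩
  have hTS : ∀ b ∈ T, b ∉ S := by
    subst hS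
    rintro b hb ⟨p, hp⟩
    obtain ⟨w, hw, hwC⟩ := hsep v (by simp) b hb p
    exact hp w hw hwC
  have hN : IsSeparator G {v} T (C.filter (fun w => w ∉ S ∧ ∃ u ∈ S, G.Adj u w)) := by
    refine ⟨hd.mono_left (Finset.filter_subset _ _), ?_⟩
    intro a ha b hb p
    rw [Finset.mem_singleton] at ha
    subst ha
    obtain ⟨w, hw, h1, h2⟩ := exists_boundary G S p hvS (hTS b hb)
    exact ⟨w, hw, Finset.mem_filter.mpr ⟨hsub w h1 h2, h1, h2⟩⟩
  have heq := Finset.eq_of_subset_of_card_le (Finset.filter_subset _ _) (hmin _ hN)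
  ext w
  constructor
  · rintro ⟨h1, h2⟩
    exact hsub w h1 h2
  · intro hw
    have hw' : w ∈ C := hw
    rw [← heq] at hw'
    exact (Finset.mem_filter.mp hw').2
end
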